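/- Let (X,d) be a separable metric space with its Borel σ-algebra, μ a probability measure on X, and l : X → {−1,1} a measurable labeling function. Let x_1,…,x_n be i.i.d. with law μ, labeled by y_i = l(x_i). Then for every n ∈ ℕ and 0 < δ < 1, with probability at least 1 − δ over the sample the following holds simultaneously for every nonempty index set S̃ ⊆ {1,…,n} with |S̃| < n and every weight function w : S̃ → (0,∞): if the WNN classifier h determined by (S̃,w) satisfies h(x_i) = y_i for all i ∈ {1,…,n}, then μ{x ∈ X : h(x) ≠ l(x)} ≤ (2/(n−|S̃|)) · (|S̃|·log(2n) + log(n/δ)). -/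

import Mathlib

open MeasureTheory

open scoped ENNReal

/-- `j` is the index selected at `z` by the weighted nearest neighbour rule with index set `S`,
weights `w` and centers `x`. -/
def IsWeightedNearest {X ι : Type*} [MetricSpace X] [LinearOrder ι] (S : Finset ι) (w : ι → ℝ)
    (x : ι → X) (z : X) (j : ι) : Prop :=
  j ∈ S ∧ (∀ k ∈ S, dist z (x j) / w j ≤ dist z (x k) / w k) ∧
    ∀ k ∈ S, dist z (x k) / w k = dist z (x j) / w j → j ≤ k

/-- The error region of the weighted nearest neighbour classifier. -/
def wnnErrorSet {X ι : Type*} [MetricSpace X] [LinearOrder ι] (l : X → Bool) (S : Finset ι)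
    (w : ι → ℝ) (x : ι → X) : Set X :=
  {z | ∃ j, IsWeightedNearest S w x z j ∧ l (x j) ≠ l z}

section WeightedNearest

variable {X ι : Type*} [MetricSpace X] [LinearOrder ι] {S : Finset ι} {w w' : ι → ℝ} {x : ι → X}

theorem IsWeightedNearest.unique {z : X} {j k : ι} (hj : IsWeightedNearest S w x z j)
    (hk : IsWeightedNearest S w x z k) : j = k := by
  have h := le_antisymm (hj.2.1 k hk.1) (hk.2.1 j hj.1)
  exact le_antisymm (hj.2.2 k hk.1 h.symm) (hk.2.2 j hj.1 h)

theorem exists_isWeightedNearest (hS : S.Nonempty) (w : ι → ℝ) (x : ι → X) (z : X) :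
    ∃ j, IsWeightedNearest S w x z j := by
  obtain ⟨j, hj, hmin⟩ := S.exists_min_image (fun k => toLex (dist z (x k) / w k, k)) hS
  refine ⟨j, hj, fun k hk => ?_, fun k hk he => ?_⟩
  · have := hmin k hk
    rw [Prod.Lex.le_iff] at this
    rcases this with h | h
    · exact h.le
    · exact h.1.le
  · have := hmin k hk
    rw [Prod.Lex.le_iff] at this
    rcases this with h | h
    · exact absurd he.symm h.ne
    · exact h.2

theorem mem_wnnErrorSet_iff {l : X → Bool} {z : X} {j : ι} (hj : IsWeightedNearest S w x z j) :
    z ∈ wnnErrorSet l S w x ↔ l (x j) ≠ l z := by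
  constructor
  · rintro ⟨k, hk, h⟩
    rwa [hj.unique hk]
  · exact fun h => ⟨j, hj, h⟩

theorem IsWeightedNearest.congr_centers {x' : ι → X} (h : ∀ j ∈ S, x j = x' j) {z : X} {j : ι}
    (hj : IsWeightedNearest S w x z j) : IsWeightedNearest S w x' z j := by
  refine ⟨hj.1, fun k hk => ?_, fun k hk => ?_⟩
  · rw [← h k hk, ← h j hj.1]; exact hj.2.1 k hk
  · rw [← h k hk, ← h j hj.1]; exact hj.2.2 k hk

theorem wnnErrorSet_congr_centers (l : X → Bool) (w : ι → ℝ) {x' : ι → X}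
    (h : ∀ j ∈ S, x j = x' j) : wnnErrorSet l S w x = wnnErrorSet l S w x' := by
  ext z
  constructor
  · rintro ⟨j, hj, hne⟩
    exact ⟨j, hj.congr_centers h, by rwa [← h j hj.1]⟩
  · rintro ⟨j, hj, hne⟩
    exact ⟨j, hj.congr_centers fun k hk => (h k hk).symm, by rwa [h j hj.1]⟩

/-- Reweighting moves every point to a cell whose weight has grown at least as much. -/
theorem IsWeightedNearest.ratio_le (hw : ∀ j ∈ S, 0 < w j) (hw' : ∀ j ∈ S, 0 < w' j) {z : X}
    {j k : ι} (hj : IsWeightedNearest S w x z j) (hk : IsWeightedNearest S w' x z k) :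
    w' j / w j ≤ w' k / w k := by
  by_contra! hlt
  have pj := hw j hj.1
  have pk := hw k hk.1
  have pj' := hw' j hj.1
  have pk' := hw' k hk.1
  have h1 := hj.2.1 k hk.1
  have h2 := hk.2.1 j hj.1
  rw [div_le_div_iff₀ pj pk] at h1
  rw [div_le_div_iff₀ pk' pj'] at h2
  rw [div_lt_div_iff₀ pk pj] at hlt
  rcases (dist_nonneg (x := z) (y := x k)).eq_or_lt with h0 | h0
  · have h0' : dist z (x j) = 0 := by
      rw [← h0, zero_mul] at h1
      exact le_antisymm (nonpos_of_mul_nonpos_left h1 pk) dist_nonneg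
    have : j = k := le_antisymm (hj.2.2 k hk.1 (by rw [← h0, h0']; simp))
      (hk.2.2 j hj.1 (by rw [← h0, h0']; simp))
    subst this
    exact lt_irrefl _ hlt
  · have h3 : dist z (x k) * (w' j * w k) ≤ dist z (x k) * (w' k * w j) := by
      calc dist z (x k) * (w' j * w k) = (dist z (x k) * w' j) * w k := by ring
        _ ≤ (dist z (x j) * w' k) * w k := by gcongr
        _ = (dist z (x j) * w k) * w' k := by ring
        _ ≤ (dist z (x k) * w j) * w' k := by gcongr
        _ = _ := by ring
    exact absurd (le_of_mul_le_mul_left h3 h0) (not_le.2 hlt)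

theorem IsWeightedNearest.eq_of_ratio_eq (hw : ∀ j ∈ S, 0 < w j) (hw' : ∀ j ∈ S, 0 < w' j)
    {z : X} {j k : ι} (hj : IsWeightedNearest S w x z j) (hk : IsWeightedNearest S w' x z k)
    (h : w' j / w j = w' k / w k) : j = k := by
  have pj := hw j hj.1
  have pk := hw k hk.1
  have pj' := hw' j hj.1
  have pk' := hw' k hk.1
  have hc : 0 < w' j / w j := by positivity
  have ej : w' j = (w' j / w j) * w j := by field_simp
  have ek : w' k = (w' j / w j) * w k := by rw [h]; field_simp
  set c := w' j / w j
  have h1 := hj.2.1 k hk.1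
  have h2 := hk.2.1 j hj.1
  have h3 : dist z (x k) / w k ≤ dist z (x j) / w j := by
    rw [ej, ek, mul_comm c, mul_comm c, ← div_div, ← div_div] at h2
    exact (div_le_div_iff_of_pos_right hc).1 h2
  have e := le_antisymm h1 h3
  refine le_antisymm (hj.2.2 k hk.1 e.symm) (hk.2.2 j hj.1 ?_)
  rw [ej, ek, mul_comm c, mul_comm c, ← div_div, ← div_div, e]

/-- An assignment of finitely many points to weighted nearest centers is determined by the
cell sizes. -/
theorem weightedNearest_assignment_ext {κ : Type*} [Fintype κ] (hw : ∀ j ∈ S, 0 < w j)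
    (hw' : ∀ j ∈ S, 0 < w' j) {z : κ → X} {a a' : κ → ι}
    (ha : ∀ i, IsWeightedNearest S w x (z i) (a i))
    (ha' : ∀ i, IsWeightedNearest S w' x (z i) (a' i))
    (h : ∀ j ∈ S, (Finset.univ.filter fun i => a i = j).card =
      (Finset.univ.filter fun i => a' i = j).card) : a = a' := by
  have hsum : ∀ b : κ → ι, (∀ i, b i ∈ S) → ∑ i, w' (b i) / w (b i) =
      ∑ j ∈ S, (Finset.univ.filter fun i => b i = j).card • (w' j / w j) := by
    intro b hb
    rw [← Finset.sum_fiberwise_of_maps_to (s := Finset.univ) (t := S) (g := b)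
      fun i _ => hb i]
    refine Finset.sum_congr rfl fun j _ => ?_
    rw [← Finset.sum_const]
    refine Finset.sum_congr rfl fun i hi => ?_
    rw [(Finset.mem_filter.1 hi).2]
  have hle : ∀ i ∈ Finset.univ, w' (a i) / w (a i) ≤ w' (a' i) / w (a' i) :=
    fun i _ => (ha i).ratio_le hw hw' (ha' i)
  have heq : ∑ i, w' (a i) / w (a i) = ∑ i, w' (a' i) / w (a' i) := by
    rw [hsum a fun i => (ha i).1, hsum a' fun i => (ha' i).1]
    exact Finset.sum_congr rfl fun j hj => by rw [h j hj]
  have := (Finset.sum_eq_sum_iff_of_le hle).1 heq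
  ext i
  exact (ha i).eq_of_ratio_eq hw hw' (ha' i) (this i (Finset.mem_univ i))

open Classical in
/-- The number of traces of error regions on a finite family of points. -/
theorem exists_finset_wnnErrorSet_traces {κ W : Type*} [Fintype κ] (hS : S.Nonempty)
    (l : X → Bool) (v : W → ι → ℝ) (hv : ∀ q, ∀ j ∈ S, 0 < v q j) (x : ι → X) (z : κ → X) :
    ∃ P : Finset (κ → Bool), P.card ≤ (Fintype.card κ + 1) ^ S.card ∧
      ∀ q, (fun i => decide (z i ∈ wnnErrorSet l S (v q) x)) ∈ P := by
  choose a ha using fun (q : W) (i : κ) => exists_isWeightedNearest hS (v q) x (z i)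
  let T : W → κ → Bool := fun q i => decide (z i ∈ wnnErrorSet l S (v q) x)
  let C : W → S → Fin (Fintype.card κ + 1) := fun q j =>
    ⟨(Finset.univ.filter fun i => a q i = j).card, Nat.lt_succ_of_le (Finset.card_le_univ _)⟩
  have hCT : ∀ q q', C q = C q' → T q = T q' := by
    intro q q' h
    have haa : a q = a q' := weightedNearest_assignment_ext (hv q) (hv q') (ha q) (ha q')
      fun j hj => congrArg Fin.val (congrFun h ⟨j, hj⟩)
    funext i
    simp only [T, mem_wnnErrorSet_iff (ha q i), mem_wnnErrorSet_iff (ha q' i), haa]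
  let rep : (S → Fin (Fintype.card κ + 1)) → κ → Bool := fun c =>
    if h : ∃ q, C q = c then T h.choose else fun _ => false
  refine ⟨Finset.univ.image rep, ?_, fun q => ?_⟩
  · refine Finset.card_image_le.trans ?_
    simp
  · refine Finset.mem_image.2 ⟨C q, Finset.mem_univ _, ?_⟩
    have h : ∃ q', C q' = C q := ⟨q, rfl⟩
    simp only [rep, dif_pos h]
    exact hCT _ _ h.choose_spec

/-- Positive weights admit rational approximations under which every weighted nearest index is
eventually stable. -/
theorem exists_rat_weights_eventually [Fintype ι] (hw : ∀ j ∈ S, 0 < w j) :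
    ∃ q : ℕ → ι → {r : ℚ // 0 < r}, ∀ (x : ι → X) z j, IsWeightedNearest S w x z j →
      ∀ᶠ s in Filter.atTop, IsWeightedNearest S (fun k => ((q s k : ℚ) : ℝ)) x z j := by
  let u : ι → ℝ := fun j => if j ∈ S then w j else 1
  have hu : ∀ j, 0 < u j := fun j => by
    by_cases h : j ∈ S <;> simp [u, h, hw]
  have huw : ∀ j ∈ S, u j = w j := fun j h => by simp [u, h]
  let r : ι → ℕ := fun j => (Finset.univ.filter fun k => j < k).card
  have hr : ∀ j k, j < k → r k + 1 ≤ r j := by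
    intro j k hjk
    refine Finset.card_lt_card (Finset.ssubset_iff_of_subset ?_ |>.2 ⟨k, ?_, ?_⟩)
    · intro i hi
      simp only [Finset.mem_filter, Finset.mem_univ, true_and] at hi ⊢
      exact hjk.trans hi
    · simpa using hjk
    · simp
  have hex : ∀ (s : ℕ) (j : ι), ∃ q : {r : ℚ // 0 < r},
      u j * (1 + (r j : ℝ) / (s + 1)) < ((q : ℚ) : ℝ) ∧
        ((q : ℚ) : ℝ) < u j * (1 + (r j + 1 : ℝ) / (s + 1)) := by
    intro s j
    have hlt : u j * (1 + (r j : ℝ) / (s + 1)) < u j * (1 + (r j + 1 : ℝ) / (s + 1)) := by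
      have := hu j
      gcongr
      linarith
    obtain ⟨q, h1, h2⟩ := exists_rat_btwn hlt
    refine ⟨⟨q, ?_⟩, h1, h2⟩
    have : 0 < u j * (1 + (r j : ℝ) / (s + 1)) := mul_pos (hu j) (by positivity)
    exact_mod_cast this.trans h1
  choose q hq1 hq2 using hex
  have hpos : ∀ s j, (0 : ℝ) < ((q s j : ℚ) : ℝ) := fun s j => by exact_mod_cast (q s j).2
  have hlim0 : ∀ c : ℝ, ∀ j, Filter.Tendsto (fun s : ℕ => u j * (1 + c / ((s : ℝ) + 1)))
      Filter.atTop (nhds (u j)) := by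
    intro c j
    have : Filter.Tendsto (fun s : ℕ => c / ((s : ℝ) + 1)) Filter.atTop (nhds 0) :=
      (tendsto_const_div_atTop_nhds_zero_nat c).comp (Filter.tendsto_add_atTop_nat 1) |>.congr
        fun s => by simp
    simpa using (this.const_add 1).const_mul (u j)
  have hlim : ∀ j, Filter.Tendsto (fun s => ((q s j : ℚ) : ℝ)) Filter.atTop (nhds (u j)) :=
    fun j => tendsto_of_tendsto_of_tendsto_of_le_of_le (hlim0 _ j) (hlim0 _ j)
      (fun s => (hq1 s j).le) fun s => (hq2 s j).le
  have hmono : ∀ s j k, j < k → ((q s k : ℚ) : ℝ) / u k ≤ ((q s j : ℚ) : ℝ) / u j := by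
    intro s j k hjk
    have h1 : ((q s k : ℚ) : ℝ) / u k ≤ 1 + (r k + 1 : ℝ) / (s + 1) := by
      rw [div_le_iff₀ (hu k), mul_comm]; exact (hq2 s k).le
    have h2 : 1 + (r j : ℝ) / (s + 1) ≤ ((q s j : ℚ) : ℝ) / u j := by
      rw [le_div_iff₀ (hu j), mul_comm]; exact (hq1 s j).le
    have h3 : (r k + 1 : ℝ) ≤ r j := by exact_mod_cast hr j k hjk
    refine h1.trans (le_trans ?_ h2)
    gcongr
  refine ⟨q, fun x z j hj => ?_⟩
  have key : ∀ k ∈ S, ∀ᶠ s in Filter.atTop,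
      dist z (x j) / ((q s j : ℚ) : ℝ) ≤ dist z (x k) / ((q s k : ℚ) : ℝ) ∧
      (dist z (x k) / ((q s k : ℚ) : ℝ) = dist z (x j) / ((q s j : ℚ) : ℝ) → j ≤ k) := by
    intro k hk
    have hle := hj.2.1 k hk
    rw [← huw j hj.1, ← huw k hk] at hle
    rcases hle.lt_or_eq with hlt | heq
    · filter_upwards [((tendsto_const_nhds.div (hlim j) (hu j).ne').eventually_lt
        (tendsto_const_nhds.div (hlim k) (hu k).ne') hlt)] with s hs
      exact ⟨hs.le, fun h => absurd h.symm hs.ne⟩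
    · have hjk : j ≤ k := hj.2.2 k hk (by rw [← huw j hj.1, ← huw k hk, heq])
      refine Filter.Eventually.of_forall fun s => ⟨?_, fun _ => hjk⟩
      rcases hjk.eq_or_lt with rfl | hjk
      · exact le_rfl
      have h1 : dist z (x j) / ((q s j : ℚ) : ℝ) =
          (dist z (x j) / u j) / (((q s j : ℚ) : ℝ) / u j) :=
        (div_div_div_cancel_right₀ (hu j).ne' _ _).symm
      have h2 : dist z (x k) / ((q s k : ℚ) : ℝ) =
          (dist z (x k) / u k) / (((q s k : ℚ) : ℝ) / u k) :=
        (div_div_div_cancel_right₀ (hu k).ne' _ _).symm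
      rw [h1, h2, heq]
      have := hu k
      exact div_le_div_of_nonneg_left (by positivity) (div_pos (hpos s k) (hu k))
        (hmono s j k hjk)
  have hall := (Filter.eventually_all_finset S).2 key
  filter_upwards [hall] with s hs
  exact ⟨hj.1, fun k hk => (hs k hk).1, fun k hk => (hs k hk).2⟩

end WeightedNearest

/-- The weight of a triple whose entries are flagged by membership in an error region: it vanishes
if the first entry is flagged, and its sum over cyclic rotations is at most `3`. -/
noncomputable def tripleWeight : Bool × Bool × Bool → ℝ≥0∞
  | (true, _, _) => 0
  | (false, true, true) => 3
  | (false, true, false) => 3 / 2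
  | (false, false, true) => 3 / 2
  | (false, false, false) => 1

theorem tripleWeight_rotations_le (a b c : Bool) :
    tripleWeight (a, b, c) + tripleWeight (b, c, a) + tripleWeight (c, a, b) ≤ 3 := by
  have h : (3 / 2 + 3 / 2 : ℝ≥0∞) = 3 := ENNReal.add_halves 3
  cases a <;> cases b <;> cases c <;> simp [tripleWeight, h]
  norm_num

theorem lintegral_tripleWeight {X : Type*} [MeasurableSpace X] (μ : Measure X)
    [IsProbabilityMeasure μ] {D : Set X} (hD : MeasurableSet D) [DecidablePred (· ∈ D)] :
    ∫⁻ g : X × X, tripleWeight (false, decide (g.1 ∈ D), decide (g.2 ∈ D)) ∂(μ.prod μ) =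
      1 + μ D + μ D ^ 2 := by
  have h32 : (1 : ℝ≥0∞) + 2⁻¹ = 3 / 2 := by
    rw [← ENNReal.toReal_eq_toReal_iff' (by simp) (by simp [ENNReal.div_eq_top])]
    rw [ENNReal.toReal_add (by simp) (by simp)]
    simp only [ENNReal.toReal_div, ENNReal.toReal_inv]
    norm_num
  have h3 : (1 : ℝ≥0∞) + 2⁻¹ + 2⁻¹ + 1 = 3 := by
    rw [add_assoc (1 : ℝ≥0∞), ENNReal.inv_two_add_inv_two]
    norm_num
  have hI : Measurable (D.indicator (1 : X → ℝ≥0∞)) := measurable_one.indicator hD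
  have hpt : ∀ g : X × X, tripleWeight (false, decide (g.1 ∈ D), decide (g.2 ∈ D)) =
      1 + 2⁻¹ * D.indicator 1 g.1 + 2⁻¹ * D.indicator 1 g.2 +
        D.indicator 1 g.1 * D.indicator 1 g.2 := by
    intro g
    by_cases h1 : g.1 ∈ D <;> by_cases h2 : g.2 ∈ D <;> simp [h1, h2, tripleWeight, h32]
    rw [← h32, h3]
  have m1 : Measurable fun g : X × X => D.indicator (1 : X → ℝ≥0∞) g.1 := hI.comp measurable_fst
  have m2 : Measurable fun g : X × X => D.indicator (1 : X → ℝ≥0∞) g.2 := hI.comp measurable_snd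
  simp_rw [hpt]
  rw [lintegral_add_left (by fun_prop), lintegral_add_left (by fun_prop),
    lintegral_add_left (by fun_prop), lintegral_const_mul _ m1, lintegral_const_mul _ m2,
    lintegral_prod_mul hI.aemeasurable hI.aemeasurable]
  have e1 : ∫⁻ g : X × X, D.indicator (1 : X → ℝ≥0∞) g.1 ∂(μ.prod μ) = μ D := by
    rw [(measurePreserving_fst (μ := μ) (ν := μ)).lintegral_comp hI, lintegral_indicator_one hD]
  have e2 : ∫⁻ g : X × X, D.indicator (1 : X → ℝ≥0∞) g.2 ∂(μ.prod μ) = μ D := by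
    rw [(measurePreserving_snd (μ := μ) (ν := μ)).lintegral_comp hI, lintegral_indicator_one hD]
  rw [e1, e2, lintegral_indicator_one hD]
  simp only [lintegral_const, measure_univ, mul_one]
  rw [add_assoc 1, ← add_mul, ENNReal.inv_two_add_inv_two, one_mul, sq]

theorem lintegral_pi_prod_eq_prod {ι Y : Type*} [Fintype ι] [MeasurableSpace Y] (ν : Measure Y)
    [IsProbabilityMeasure ν] (f : ι → Y → ℝ≥0∞) (hf : ∀ i, Measurable (f i)) :
    ∫⁻ g, ∏ i, f i (g i) ∂(Measure.pi fun _ : ι => ν) = ∏ i, ∫⁻ y, f i y ∂ν := by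
  rw [ProbabilityTheory.lintegral_prod_eq_prod_lintegral_of_indepFun Finset.univ
    (fun i (g : ι → Y) => f i (g i))
    (ProbabilityTheory.iIndepFun_pi fun i => (hf i).aemeasurable)
    fun i => (hf i).comp (measurable_pi_apply i)]
  refine Finset.prod_congr rfl fun i _ => ?_
  exact (measurePreserving_eval (fun _ : ι => ν) i).lintegral_comp (hf i)

/-- Cyclic rotation of a triple. -/
def rotateTriple {X : Type*} (k : Fin 3) (p : X × X × X) : X × X × X :=
  ![p, (p.2.1, p.2.2, p.1), (p.2.2, p.1, p.2.1)] k

theorem measurePreserving_rotateTriple {X : Type*} [MeasurableSpace X] (μ : Measure X)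
    [IsProbabilityMeasure μ] (k : Fin 3) :
    MeasurePreserving (rotateTriple k) (μ.prod (μ.prod μ)) (μ.prod (μ.prod μ)) := by
  have h1 : MeasurePreserving (fun p : X × X × X => (p.2.1, p.2.2, p.1))
      (μ.prod (μ.prod μ)) (μ.prod (μ.prod μ)) :=
    (measurePreserving_prodAssoc μ μ μ).comp Measure.measurePreserving_swap
  fin_cases k
  · exact MeasurePreserving.id _
  · exact h1
  · exact h1.comp h1

open Classical in
theorem measurable_decide_mem_section {X T Y : Type*} [MeasurableSpace X] [MeasurableSpace T]
    [MeasurableSpace Y] {E : T → Set X} (hE : MeasurableSet {p : T × X | p.2 ∈ E p.1})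
    {f : Y → T} {g : Y → X} (hf : Measurable f) (hg : Measurable g) :
    Measurable fun y => decide (g y ∈ E (f y)) := by
  refine measurable_to_bool ?_
  have : (fun y => decide (g y ∈ E (f y))) ⁻¹' {true} =
      (fun y => (f y, g y)) ⁻¹' {p | p.2 ∈ E p.1} := by
    ext y; simp
  rw [this]
  exact (hf.prodMk hg) hE

theorem sum_iSup_prod_rotations_le {ι W : Type*} [Fintype ι] [DecidableEq ι] (S : Finset ι)
    {P : Finset (ι × Fin 3 → Bool)} {b : W → ι × Fin 3 → Bool} (hb : ∀ q, b q ∈ P) :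
    ∑ k : ι → Fin 3, ⨆ q, ∏ i, (if i ∈ S then 1 else
      tripleWeight (rotateTriple (k i) (b q (i, 0), b q (i, 1), b q (i, 2)))) ≤
      3 ^ Fintype.card ι * P.card := by
  have h3 : ∀ (p : ι × Fin 3 → Bool) (i : ι), ∑ k : Fin 3, (if i ∈ S then 1 else
      tripleWeight (rotateTriple k (p (i, 0), p (i, 1), p (i, 2)))) ≤ 3 := by
    intro p i
    by_cases hi : i ∈ S
    · simp [hi]
    · simp only [hi, if_false, Fin.sum_univ_three]
      exact tripleWeight_rotations_le _ _ _
  calc _ ≤ ∑ k : ι → Fin 3, ∑ p ∈ P, ∏ i, (if i ∈ S then 1 else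
        tripleWeight (rotateTriple (k i) (p (i, 0), p (i, 1), p (i, 2)))) :=
        Finset.sum_le_sum fun k _ => iSup_le fun q =>
          Finset.single_le_sum (f := fun p : ι × Fin 3 → Bool => ∏ i, (if i ∈ S then 1 else
            tripleWeight (rotateTriple (k i) (p (i, 0), p (i, 1), p (i, 2)))))
            (fun _ _ => zero_le) (hb q)
    _ = ∑ p ∈ P, ∏ i, ∑ k : Fin 3, (if i ∈ S then 1 else
        tripleWeight (rotateTriple k (p (i, 0), p (i, 1), p (i, 2)))) := by
        rw [Finset.sum_comm]
        refine Finset.sum_congr rfl fun p _ => ?_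
        rw [Finset.prod_univ_sum, Fintype.piFinset_univ]
    _ ≤ ∑ p ∈ P, ∏ _i : ι, (3 : ℝ≥0∞) :=
        Finset.sum_le_sum fun p _ => Finset.prod_le_prod' fun i _ => h3 p i
    _ = 3 ^ Fintype.card ι * P.card := by
        rw [Finset.prod_const, Finset.card_univ, Finset.sum_const, nsmul_eq_mul, mul_comm]

open Classical in
/-- Uniform deviation bound for consistent hypotheses: if every finite family of `3 * card ι`
points has at most `K` traces on the error regions, then the event that some error region of mass
at least `t` is missed by the sample points outside `S` has measure at most
`K / (1 + t + t ^ 2) ^ (card ι - card S)`. The error regions may depend on the sample points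
indexed by `S`. -/
theorem pow_mul_measure_exists_consistent_le {X ι W : Type*} [MeasurableSpace X] (μ : Measure X)
    [IsProbabilityMeasure μ] [Fintype ι] [Countable W] (S : Finset ι)
    (E : W → (ι → X) → Set X)
    (hEm : ∀ q, MeasurableSet {p : (ι → X) × X | p.2 ∈ E q p.1})
    (hE : ∀ q x x', (∀ j ∈ S, x j = x' j) → E q x = E q x') (K : ℕ)
    (hK : ∀ (x : ι → X) (z : ι × Fin 3 → X), ∃ P : Finset (ι × Fin 3 → Bool), P.card ≤ K ∧
      ∀ q, (fun i => decide (z i ∈ E q x)) ∈ P) {t c : ℝ≥0∞} (hc : c ≤ 1 + t + t ^ 2) :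
    c ^ (Fintype.card ι - S.card) * (Measure.pi fun _ : ι => μ)
      {x | ∃ q, (∀ i, i ∉ S → x i ∉ E q x) ∧ t ≤ μ (E q x)} ≤ K := by
  set π := Measure.pi fun _ : ι => μ
  set ρ := Measure.pi fun _ : ι => μ.prod μ
  set m := Fintype.card ι - S.card
  let G : W → (ι → X) → (ι → X × X × X) → ℝ≥0∞ := fun q x ω => ∏ i, if i ∈ S then 1 else
    tripleWeight (decide ((ω i).1 ∈ E q x), decide ((ω i).2.1 ∈ E q x),
      decide ((ω i).2.2 ∈ E q x))
  let F : (ι → X × X × X) → ℝ≥0∞ := fun ω => ⨆ q, G q (fun i => (ω i).1) ω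
  let F' : (ι → X) × (ι → X × X) → ℝ≥0∞ := fun p => F fun i => (p.1 i, p.2 i)
  have htw : Measurable tripleWeight := measurable_of_countable _
  have hFm : Measurable F := by
    refine Measurable.iSup fun q => Finset.measurable_prod _ fun i _ => ?_
    by_cases hi : i ∈ S
    · simp [hi]
    · simp only [hi, if_false]
      have hx : Measurable fun (ω : ι → X × X × X) i => (ω i).1 := by fun_prop
      exact htw.comp ((measurable_decide_mem_section (hEm q) hx (by fun_prop)).prodMk
        ((measurable_decide_mem_section (hEm q) hx (by fun_prop)).prodMk
          (measurable_decide_mem_section (hEm q) hx (by fun_prop))))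
  have hF'm : Measurable F' := hFm.comp (by fun_prop)
  have hlow : c ^ m * π {x | ∃ q, (∀ i, i ∉ S → x i ∉ E q x) ∧ t ≤ μ (E q x)} ≤
      ∫⁻ x, ∫⁻ g, F' (x, g) ∂ρ ∂π := by
    refine le_trans ?_ (mul_meas_ge_le_lintegral (Measurable.lintegral_prod_right' hF'm) (c ^ m))
    refine mul_le_mul_right (measure_mono ?_) _
    rintro x ⟨q, hq, ht⟩
    change c ^ m ≤ ∫⁻ g, F' (x, g) ∂ρ
    have hD : MeasurableSet (E q x) := measurable_prodMk_left (hEm q)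
    calc c ^ m ≤ (1 + μ (E q x) + μ (E q x) ^ 2) ^ m := by
          gcongr; exact hc.trans (by gcongr)
      _ = ∏ i : ι, if i ∈ S then 1 else (1 + μ (E q x) + μ (E q x) ^ 2) := by
          rw [Finset.prod_ite, Finset.prod_const_one, one_mul, Finset.prod_const]
          congr 1
          rw [Finset.filter_not, Finset.card_sdiff_of_subset (Finset.filter_subset _ _)]
          simp [m]
      _ = ∏ i : ι, ∫⁻ y : X × X, (if i ∈ S then 1 else
            tripleWeight (false, decide (y.1 ∈ E q x), decide (y.2 ∈ E q x))) ∂(μ.prod μ) := by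
          refine Finset.prod_congr rfl fun i _ => ?_
          by_cases hi : i ∈ S
          · simp [hi]
          · simp only [hi, if_false]
            rw [lintegral_tripleWeight μ hD]
      _ = ∫⁻ g, ∏ i : ι, (if i ∈ S then 1 else
            tripleWeight (false, decide ((g i).1 ∈ E q x), decide ((g i).2 ∈ E q x))) ∂ρ := by
          refine (lintegral_pi_prod_eq_prod (μ.prod μ) (fun (i : ι) (y : X × X) => if i ∈ S then 1
            else tripleWeight (false, decide (y.1 ∈ E q x), decide (y.2 ∈ E q x)))
            fun i => ?_).symm
          by_cases hi : i ∈ S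
          · simp [hi]
          · simp only [hi, if_false]
            exact htw.comp (measurable_const.prodMk
              ((measurable_decide_mem_section (hEm q) measurable_const measurable_fst).prodMk
                (measurable_decide_mem_section (hEm q) measurable_const measurable_snd)))
      _ ≤ ∫⁻ g, F' (x, g) ∂ρ := by
          refine lintegral_mono fun g => le_iSup_of_le q (le_of_eq ?_)
          refine Finset.prod_congr rfl fun i _ => ?_
          by_cases hi : i ∈ S
          · simp [hi]
          · simp [hi, hq i hi]
  have hswap : ∫⁻ x, ∫⁻ g, F' (x, g) ∂ρ ∂π =
      ∫⁻ ω, F ω ∂(Measure.pi fun _ : ι => μ.prod (μ.prod μ)) := by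
    rw [← lintegral_prod _ hF'm.aemeasurable]
    exact ((measurePreserving_arrowProdEquivProdArrow X (X × X) ι (fun _ => μ)
      (fun _ => μ.prod μ)).lintegral_comp hF'm).symm
  let R : (ι → Fin 3) → (ι → X × X × X) → (ι → X × X × X) := fun k ω i =>
    if i ∈ S then ω i else rotateTriple (k i) (ω i)
  have hR : ∀ k, ∫⁻ ω, F (R k ω) ∂(Measure.pi fun _ : ι => μ.prod (μ.prod μ)) =
      ∫⁻ ω, F ω ∂(Measure.pi fun _ : ι => μ.prod (μ.prod μ)) := by
    intro k
    have : MeasurePreserving (R k) (Measure.pi fun _ : ι => μ.prod (μ.prod μ))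
        (Measure.pi fun _ : ι => μ.prod (μ.prod μ)) := by
      refine measurePreserving_pi (f := fun i p => if i ∈ S then p else rotateTriple (k i) p)
        _ _ fun i => ?_
      by_cases hi : i ∈ S
      · simp only [hi, if_true]; exact MeasurePreserving.id _
      · simp only [hi, if_false]; exact measurePreserving_rotateTriple μ (k i)
    exact this.lintegral_comp hFm
  have hpt : ∀ ω, ∑ k, F (R k ω) ≤ 3 ^ Fintype.card ι * K := by
    intro ω
    obtain ⟨P, hPK, hP⟩ := hK (fun i => (ω i).1)
      fun p => ![(ω p.1).1, (ω p.1).2.1, (ω p.1).2.2] p.2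
    have h1 : ∀ k, F (R k ω) = ⨆ q, ∏ i, if i ∈ S then 1 else tripleWeight
        (rotateTriple (k i) (decide ((ω i).1 ∈ E q fun i => (ω i).1),
          decide ((ω i).2.1 ∈ E q fun i => (ω i).1),
          decide ((ω i).2.2 ∈ E q fun i => (ω i).1))) := by
      intro k
      refine iSup_congr fun q => ?_
      have hEq : E q (fun i => (R k ω i).1) = E q (fun i => (ω i).1) :=
        hE q _ _ fun j hj => by simp [R, hj]
      simp only [G, hEq]
      refine Finset.prod_congr rfl fun i _ => ?_
      by_cases hi : i ∈ S
      · simp only [hi, if_true]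
      · simp only [hi, R, if_false]
        generalize k i = r
        fin_cases r <;> rfl
    rw [Finset.sum_congr rfl fun k _ => h1 k]
    refine (sum_iSup_prod_rotations_le S hP).trans ?_
    gcongr
  have hup : 3 ^ Fintype.card ι * ∫⁻ ω, F ω ∂(Measure.pi fun _ : ι => μ.prod (μ.prod μ)) ≤
      3 ^ Fintype.card ι * K := by
    calc _ = ∑ k, ∫⁻ ω, F (R k ω) ∂(Measure.pi fun _ : ι => μ.prod (μ.prod μ)) := by
          simp_rw [hR]
          simp
      _ = ∫⁻ ω, ∑ k, F (R k ω) ∂(Measure.pi fun _ : ι => μ.prod (μ.prod μ)) := by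
          refine (lintegral_finsetSum _ fun k _ => hFm.comp ?_).symm
          refine measurable_pi_lambda _ fun i => ?_
          by_cases hi : i ∈ S
          · simp only [R, hi, if_true]; fun_prop
          · simp only [R, hi, if_false]
            exact (measurePreserving_rotateTriple μ (k i)).measurable.comp (measurable_pi_apply i)
      _ ≤ ∫⁻ _, 3 ^ Fintype.card ι * K ∂(Measure.pi fun _ : ι => μ.prod (μ.prod μ)) :=
          lintegral_mono hpt
      _ = _ := by simp
  rw [hswap] at hlow
  exact hlow.trans ((ENNReal.mul_le_mul_iff_right (by simp) (by simp)).1 hup)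

theorem measurableSet_mem_wnnErrorSet {X ι : Type*} [MetricSpace X]
    [SecondCountableTopology X] [MeasurableSpace X] [BorelSpace X] [Fintype ι] [LinearOrder ι]
    {l : X → Bool} (hl : Measurable l) (S : Finset ι) (w : ι → ℝ) :
    MeasurableSet {p : (ι → X) × X | p.2 ∈ wnnErrorSet l S w p.1} := by
  have hd : ∀ j, Measurable fun p : (ι → X) × X => dist p.2 (p.1 j) / w j := fun j =>
    (measurable_snd.dist ((measurable_pi_apply j).comp measurable_fst)).div_const _
  have hlj : ∀ j, Measurable fun p : (ι → X) × X => l (p.1 j) := fun j =>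
    hl.comp ((measurable_pi_apply j).comp measurable_fst)
  have : {p : (ι → X) × X | p.2 ∈ wnnErrorSet l S w p.1} = ⋃ j, ({_p | j ∈ S} ∩
      ((⋂ k ∈ S, {p | dist p.2 (p.1 j) / w j ≤ dist p.2 (p.1 k) / w k}) ∩
        ⋂ k ∈ S, ({p | dist p.2 (p.1 k) / w k = dist p.2 (p.1 j) / w j}ᶜ ∪ {_p | j ≤ k}))) ∩
        {p | l (p.1 j) = l p.2}ᶜ := by
    ext p
    simp [wnnErrorSet, IsWeightedNearest, imp_iff_not_or]
  rw [this]
  refine MeasurableSet.iUnion fun j => ((MeasurableSet.const _).inter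
    ((Finset.measurableSet_biInter _ fun k _ => measurableSet_le (hd j) (hd k)).inter
      (Finset.measurableSet_biInter _ fun k _ =>
        (measurableSet_eq_fun (hd k) (hd j)).compl.union (MeasurableSet.const _)))).inter
    (measurableSet_eq_fun (hlj j) (hl.comp measurable_snd)).compl

/-- A consistent weight vector with large error can be replaced by a rational one. -/
theorem exists_rat_consistent {X ι : Type*} [MetricSpace X] [MeasurableSpace X] (μ : Measure X)
    [Fintype ι] [LinearOrder ι] {l : X → Bool} {S : Finset ι} (hS : S.Nonempty) {w : ι → ℝ}
    (hw : ∀ j ∈ S, 0 < w j) {x : ι → X} (hx : ∀ i, x i ∉ wnnErrorSet l S w x) {t : ℝ≥0∞}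
    (ht : t < μ (wnnErrorSet l S w x)) :
    ∃ q : ι → {r : ℚ // 0 < r}, (∀ i, x i ∉ wnnErrorSet l S (fun k => ((q k : ℚ) : ℝ)) x) ∧
      t ≤ μ (wnnErrorSet l S (fun k => ((q k : ℚ) : ℝ)) x) := by
  obtain ⟨q, hq⟩ := exists_rat_weights_eventually (X := X) hw
  have hmem : ∀ z, ∀ᶠ s in Filter.atTop, (z ∈ wnnErrorSet l S (fun k => ((q s k : ℚ) : ℝ)) x ↔
      z ∈ wnnErrorSet l S w x) := by
    intro z
    obtain ⟨j, hj⟩ := exists_isWeightedNearest hS w x z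
    filter_upwards [hq x z j hj] with s hs
    rw [mem_wnnErrorSet_iff hs, mem_wnnErrorSet_iff hj]
  let A : ℕ → Set X := fun N => {z | ∀ s ≥ N, z ∈ wnnErrorSet l S (fun k => ((q s k : ℚ) : ℝ)) x}
  have hA : Monotone A := fun N M hNM z hz s hs => hz s (hNM.trans hs)
  have hsub : wnnErrorSet l S w x ⊆ ⋃ N, A N := by
    intro z hz
    obtain ⟨N, hN⟩ := Filter.eventually_atTop.1 (hmem z)
    exact Set.mem_iUnion.2 ⟨N, fun s hs => (hN s hs).2 hz⟩
  have hlt := ht.trans_le (measure_mono hsub)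
  rw [hA.measure_iUnion] at hlt
  obtain ⟨N, hN⟩ := lt_iSup_iff.1 hlt
  obtain ⟨M, hM⟩ := Filter.eventually_atTop.1
    (Filter.eventually_all.2 fun i => hmem (x i))
  refine ⟨q (max N M), fun i hi => hx i ((hM _ (le_max_right _ _) i).1 hi), ?_⟩
  exact hN.le.trans (measure_mono fun z hz => hz _ (le_max_left _ _))

theorem measure_exists_rat_consistent_le {X : Type*} [MetricSpace X]
    [SecondCountableTopology X] [MeasurableSpace X] [BorelSpace X] (μ : Measure X)
    [IsProbabilityMeasure μ] {l : X → Bool} (hl : Measurable l) {n : ℕ} {S : Finset (Fin n)}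
    (hS : S.Nonempty) {ε : ℝ} (hε0 : 0 ≤ ε) (hε1 : ε ≤ 1) :
    (Measure.pi fun _ : Fin n => μ) {x | ∃ q : Fin n → {r : ℚ // 0 < r},
      (∀ i, x i ∉ wnnErrorSet l S (fun k => ((q k : ℚ) : ℝ)) x) ∧
        ENNReal.ofReal ε ≤ μ (wnnErrorSet l S (fun k => ((q k : ℚ) : ℝ)) x)} ≤
      ENNReal.ofReal ((3 * n + 1) ^ S.card * Real.exp (-(((n - S.card : ℕ) : ℝ) * ε))) := by
  have hexp : Real.exp ε ≤ 1 + ε + ε ^ 2 := by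
    have := (abs_le.1 (Real.abs_exp_sub_one_sub_id_le (x := ε) (by rwa [abs_of_nonneg hε0]))).2
    linarith
  have hc : ENNReal.ofReal (Real.exp ε) ≤ 1 + ENNReal.ofReal ε + ENNReal.ofReal ε ^ 2 := by
    rw [← ENNReal.ofReal_pow hε0, ← ENNReal.ofReal_one, ← ENNReal.ofReal_add zero_le_one hε0,
      ← ENNReal.ofReal_add (by positivity) (by positivity)]
    exact ENNReal.ofReal_le_ofReal hexp
  have key := pow_mul_measure_exists_consistent_le μ S
    (fun (q : Fin n → {r : ℚ // 0 < r}) (x : Fin n → X) =>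
      wnnErrorSet l S (fun k => ((q k : ℚ) : ℝ)) x)
    (fun q => measurableSet_mem_wnnErrorSet hl S _)
    (fun q x x' h => wnnErrorSet_congr_centers l _ h)
    ((3 * n + 1) ^ S.card)
    (fun x z => by
      obtain ⟨P, hP, hq⟩ := exists_finset_wnnErrorSet_traces hS l
        (fun (q : Fin n → {r : ℚ // 0 < r}) k => ((q k : ℚ) : ℝ))
        (fun q j _ => by exact_mod_cast (q j).2) x z
      refine ⟨P, hP.trans (le_of_eq ?_), hq⟩
      simp [mul_comm]) hc
  rw [Fintype.card_fin, ← ENNReal.ofReal_pow (Real.exp_pos _).le, ← Real.exp_nat_mul] at key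
  have hpos := Real.exp_pos (((n - S.card : ℕ) : ℝ) * ε)
  rw [Real.exp_neg, ← div_eq_mul_inv, ENNReal.ofReal_div_of_pos hpos,
    ENNReal.le_div_iff_mul_le (.inl (by simpa using hpos)) (.inl ENNReal.ofReal_ne_top), mul_comm]
  refine (mul_le_mul_right (measure_mono ?_) _).trans (key.trans (le_of_eq ?_))
  · rintro x ⟨q, h1, h2⟩
    exact ⟨q, fun i _ => h1 i, h2⟩
  · rw [ENNReal.ofReal_pow (by positivity), ENNReal.ofReal_add (by positivity) zero_le_one,
      ENNReal.ofReal_mul (by norm_num)]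
    simp

theorem pow_mul_exp_neg_le {n k : ℕ} (hn : 0 < n) {δ : ℝ} (hδ : 0 < δ) :
    (3 * n + 1 : ℝ) ^ k * Real.exp (-(2 * (k * Real.log (2 * n) + Real.log (n / δ)))) ≤
      (1 / n : ℝ) ^ k * (δ / n) ^ 2 := by
  have hn' : (1 : ℝ) ≤ n := by exact_mod_cast hn
  have e : Real.exp (-(2 * (k * Real.log (2 * n) + Real.log (n / δ)))) =
      (1 / (2 * n) ^ 2) ^ k * (δ / n) ^ 2 := by
    rw [show -(2 * (k * Real.log (2 * n) + Real.log (n / δ))) =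
        -(((2 * k : ℕ) : ℝ) * Real.log (2 * n) + ((2 : ℕ) : ℝ) * Real.log (n / δ)) by
        push_cast; ring, Real.exp_neg, Real.exp_add, Real.exp_nat_mul, Real.exp_nat_mul,
      Real.exp_log (by positivity), Real.exp_log (by positivity), pow_mul]
    rw [mul_inv, one_div, inv_pow, ← inv_pow (n / δ : ℝ) 2, inv_div]
  rw [e, ← mul_assoc, ← mul_pow]
  gcongr
  rw [mul_one_div, div_le_div_iff₀ (by positivity) (by positivity)]
  nlinarith

theorem sum_finset_pow_mul_sq_le {n : ℕ} (hn : 2 ≤ n) {δ : ℝ} (hδ0 : 0 < δ) (hδ1 : δ < 1) :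
    ∑ S : Finset (Fin n), (1 / n : ℝ) ^ S.card * (δ / n) ^ 2 ≤ δ := by
  have hn' : (2 : ℝ) ≤ n := by exact_mod_cast hn
  have h1 : ∑ S : Finset (Fin n), (1 / n : ℝ) ^ S.card = (1 / n + 1 : ℝ) ^ n := by
    rw [← Fin.sum_pow_mul_eq_add_pow]
    simp
  have h2 : (1 / n + 1 : ℝ) ^ n ≤ Real.exp 1 := by
    calc (1 / n + 1 : ℝ) ^ n ≤ Real.exp (1 / n) ^ n := by
          gcongr; exact Real.add_one_le_exp _
      _ = Real.exp 1 := by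
          rw [← Real.exp_nat_mul]; congr 1; field_simp
  rw [← Finset.sum_mul, h1]
  have h3 := Real.exp_one_lt_d9
  calc (1 / n + 1 : ℝ) ^ n * (δ / n) ^ 2 ≤ 4 * (δ / n) ^ 2 := by
        gcongr; linarith
    _ ≤ 4 * (δ / 2) ^ 2 := by gcongr
    _ ≤ δ := by nlinarith

/-- Generalization bound for consistent WNN classifiers (Theorem 3, non-permutation-
invariant case).  The sample is `n` i.i.d. points with law `μ` (encoded by the product
measure), labeled by `l`.  For an index set `S̃` and weights `w`, the WNN classifier
`h` determined by `(S̃, w)` (ties broken toward the smallest index) is pinned down by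
the displayed pointwise property.  With probability at least `1 - δ`, every consistent
such classifier with `|S̃| < n` has error at most
`(2/(n-|S̃|))·(|S̃|·log(2n) + log(n/δ))`. -/
theorem stmt4 {X : Type*} [MetricSpace X] [TopologicalSpace.SeparableSpace X]
    [MeasurableSpace X] [BorelSpace X]
    (μ : Measure X) [IsProbabilityMeasure μ]
    (l : X → Bool) (hl : Measurable l)
    (n : ℕ) (hn : 0 < n) (δ : ℝ) (hδ0 : 0 < δ) (hδ1 : δ < 1) :
    1 - ENNReal.ofReal δ ≤
      (Measure.pi fun _ : Fin n => μ)
        {xs : Fin n → X |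
          ∀ (St : Finset (Fin n)) (w : Fin n → ℝ) (h : X → Bool),
            St.Nonempty → St.card < n → (∀ j ∈ St, 0 < w j) →
            (∀ z : X, ∃ j ∈ St, h z = l (xs j) ∧
              (∀ k ∈ St, dist z (xs j) / w j ≤ dist z (xs k) / w k) ∧
              (∀ k ∈ St, dist z (xs k) / w k = dist z (xs j) / w j → j ≤ k)) →
            (∀ i : Fin n, h (xs i) = l (xs i)) →
            (μ {x | h x ≠ l x}).toReal ≤
              2 / ((n : ℝ) - St.card) *
                (St.card * Real.log (2 * n) + Real.log (n / δ))} := by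
  have : SecondCountableTopology X := UniformSpace.secondCountable_of_separable X
  set π := Measure.pi fun _ : Fin n => μ
  let ε : Finset (Fin n) → ℝ := fun S =>
    2 / ((n : ℝ) - S.card) * (S.card * Real.log (2 * n) + Real.log (n / δ))
  let T : Finset (Finset (Fin n)) :=
    Finset.univ.filter fun S => S.Nonempty ∧ S.card < n ∧ ε S ≤ 1
  let B : Finset (Fin n) → Set (Fin n → X) := fun S =>
    {x | ∃ q : Fin n → {r : ℚ // 0 < r},
      (∀ i, x i ∉ wnnErrorSet l S (fun k => ((q k : ℚ) : ℝ)) x) ∧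
        ENNReal.ofReal (ε S) ≤ μ (wnnErrorSet l S (fun k => ((q k : ℚ) : ℝ)) x)}
  have hn1 : (1 : ℝ) ≤ n := by exact_mod_cast hn
  have hε : ∀ S : Finset (Fin n), S.card < n → 0 ≤ ε S := by
    intro S hS
    have h1 : (0 : ℝ) < (n : ℝ) - S.card := sub_pos.2 (by exact_mod_cast hS)
    have h2 : 0 ≤ Real.log (2 * n) := Real.log_nonneg (by linarith)
    have h3 : 0 ≤ Real.log (n / δ) := Real.log_nonneg (by rw [le_div_iff₀ hδ0]; linarith)
    positivity
  have hB : ∀ S ∈ T, π (B S) ≤ ENNReal.ofReal ((1 / n : ℝ) ^ S.card * (δ / n) ^ 2) := by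
    intro S hS
    obtain ⟨-, hne, hcard, h1⟩ := Finset.mem_filter.1 hS
    refine (measure_exists_rat_consistent_le μ hl hne (hε S hcard) h1).trans
      (ENNReal.ofReal_le_ofReal (le_trans (le_of_eq ?_) (pow_mul_exp_neg_le hn hδ0)))
    have h1 : (n : ℝ) - S.card ≠ 0 := (sub_pos.2 (by exact_mod_cast hcard)).ne'
    rw [Nat.cast_sub hcard.le]
    simp only [ε]
    congr 3
    field_simp
  have hU : π (⋃ S ∈ T, B S) ≤ ENNReal.ofReal δ := by
    rcases T.eq_empty_or_nonempty with hT | ⟨S₀, hS₀⟩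
    · simp [hT]
    have hn2 : 2 ≤ n := by
      obtain ⟨-, hne, hcard, -⟩ := Finset.mem_filter.1 hS₀
      have := hne.card_pos
      omega
    calc π (⋃ S ∈ T, B S) ≤ ∑ S ∈ T, π (B S) := measure_biUnion_finset_le _ _
      _ ≤ ∑ S ∈ T, ENNReal.ofReal ((1 / n : ℝ) ^ S.card * (δ / n) ^ 2) := Finset.sum_le_sum hB
      _ ≤ ∑ S : Finset (Fin n), ENNReal.ofReal ((1 / n : ℝ) ^ S.card * (δ / n) ^ 2) :=
          Finset.sum_le_sum_of_subset (Finset.subset_univ _)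
      _ = ENNReal.ofReal (∑ S : Finset (Fin n), (1 / n : ℝ) ^ S.card * (δ / n) ^ 2) :=
          (ENNReal.ofReal_sum_of_nonneg fun _ _ => by positivity).symm
      _ ≤ ENNReal.ofReal δ := ENNReal.ofReal_le_ofReal (sum_finset_pow_mul_sq_le hn2 hδ0 hδ1)
  refine tsub_le_iff_right.2 (le_trans ?_ (add_le_add_right hU _))
  rw [← measure_univ (μ := π)]
  refine (measure_mono fun x _ => ?_).trans (measure_union_le _ _)
  by_contra hx
  rw [Set.mem_union, not_or] at hx
  refine hx.1 fun S w h hne hcard hw hnear hcons => ?_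
  by_contra! hlt
  have herr : {z | h z ≠ l z} = wnnErrorSet l S w x := by
    ext z
    obtain ⟨j, hj, hz, hmin⟩ := hnear z
    rw [mem_wnnErrorSet_iff (j := j) ⟨hj, hmin⟩, Set.mem_ofPred_eq, hz]
  rw [herr] at hlt
  have hle1 : ε S ≤ 1 := hlt.le.trans
    (ENNReal.toReal_le_of_le_ofReal zero_le_one (by simpa using prob_le_one))
  refine hx.2 (Set.mem_biUnion (x := S) (by simp [T, hne, hcard, hle1]) ?_)
  refine exists_rat_consistent μ hne hw (fun i hi => ?_)
    ((ENNReal.ofReal_lt_iff_lt_toReal (hε S hcard) (measure_ne_top _ _)).2 hlt)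
  rw [← herr] at hi
  exact hi (hcons i)
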